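/- arXiv:0904.0990 — 2 statements merged into one kernel-verified Lean document; each statement's English description precedes it below -/
import Mathlib

section
/- Let n ≥ 2, r > 0, and let f be a C² real-valued function on the closed ball B̄_r ⊂ ℝⁿ of radius r. Then the infimum over x ∈ B̄_r of |H(x)| is strictly less than 1/r; equivalently, there exists a point x ∈ B̄_r with |H(x)| < 1/r. -/
open Metric Finset

/-- Coordinates of the gradient of `f` at `x`. -/
noncomputable def grad (n : ℕ) (f : EuclideanSpace ℝ (Fin n) → ℝ)
    (x : EuclideanSpace ℝ (Fin n)) : Fin n → ℝ :=
  fun i => fderiv ℝ f x (EuclideanSpace.single i 1)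

/-- The Hessian matrix `D²f(x)`. -/
noncomputable def hess (n : ℕ) (f : EuclideanSpace ℝ (Fin n) → ℝ)
    (x : EuclideanSpace ℝ (Fin n)) : Matrix (Fin n) (Fin n) ℝ :=
  Matrix.of fun i j =>
    fderiv ℝ (fun y => fderiv ℝ f y (EuclideanSpace.single j 1)) x (EuclideanSpace.single i 1)

/-- `|∇f(x)|²`. -/
noncomputable def gradSq (n : ℕ) (f : EuclideanSpace ℝ (Fin n) → ℝ)
    (x : EuclideanSpace ℝ (Fin n)) : ℝ :=
  ∑ i, grad n f x i ^ 2

/-- The shape operator of the graph of `f`, with respect to the upward unit normal: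
`W(x) = (1+|∇f|²)^{-1/2} (Iₙ - ∇f ∇fᵀ/(1+|∇f|²)) D²f(x)`. -/
noncomputable def shapeOp (n : ℕ) (f : EuclideanSpace ℝ (Fin n) → ℝ)
    (x : EuclideanSpace ℝ (Fin n)) : Matrix (Fin n) (Fin n) ℝ :=
  (Real.sqrt (1 + gradSq n f x))⁻¹ •
    (((1 : Matrix (Fin n) (Fin n) ℝ) -
      Matrix.of fun i j => grad n f x i * grad n f x j / (1 + gradSq n f x)) * hess n f x)

/-- The mean curvature `H(x) = tr W(x) / n`. -/
noncomputable def meanCurv (n : ℕ) (f : EuclideanSpace ℝ (Fin n) → ℝ)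
    (x : EuclideanSpace ℝ (Fin n)) : ℝ :=
  (shapeOp n f x).trace / n

/-- The scalar curvature `R(x) = ((tr W)² - tr(W²)) / (n(n-1))`. -/
noncomputable def scalarCurv (n : ℕ) (f : EuclideanSpace ℝ (Fin n) → ℝ)
    (x : EuclideanSpace ℝ (Fin n)) : ℝ :=
  ((shapeOp n f x).trace ^ 2 - (shapeOp n f x * shapeOp n f x).trace) /
    ((n : ℝ) * ((n : ℝ) - 1))

/-- The length `|A|(x) = √(tr(W(x)²))` of the second fundamental form. -/
noncomputable def normA (n : ℕ) (f : EuclideanSpace ℝ (Fin n) → ℝ)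
    (x : EuclideanSpace ℝ (Fin n)) : ℝ :=
  Real.sqrt ((shapeOp n f x * shapeOp n f x).trace)

/-- The second derivative of a real function is nonpositive at a local maximum. -/
theorem IsLocalMax.deriv_deriv_nonpos {g : ℝ → ℝ} {a : ℝ} (h : IsLocalMax g a)
    (hg : ContinuousAt g a) : deriv (deriv g) a ≤ 0 := by
  by_contra! hpos
  have hmin : IsLocalMin g a := isLocalMin_of_deriv_deriv_pos hpos h.deriv_eq_zero hg
  have hconst : g =ᶠ[nhds a] fun _ => g a := by
    filter_upwards [h, hmin] with t h₁ h₂ using le_antisymm h₁ h₂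
  have := hconst.deriv.deriv_eq
  simp at this
  linarith

section Derivatives

variable {n : ℕ} {f : EuclideanSpace ℝ (Fin n) → ℝ}

theorem hess_apply (hf : ContDiff ℝ 2 f) (x : EuclideanSpace ℝ (Fin n)) (i j : Fin n) :
    hess n f x i j = fderiv ℝ (fderiv ℝ f) x (EuclideanSpace.single i 1)
      (EuclideanSpace.single j 1) := by
  have hd : DifferentiableAt ℝ (fderiv ℝ f) x :=
    (hf.fderiv_right (m := 1) (by norm_num)).differentiable (by norm_num) x
  simp only [hess, Matrix.of_apply]
  rw [fderiv_clm_apply hd (differentiableAt_const _)]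
  simp

theorem fderiv_fderiv_apply_eq_sum_hess (hf : ContDiff ℝ 2 f)
    (x v w : EuclideanSpace ℝ (Fin n)) :
    fderiv ℝ (fderiv ℝ f) x v w = ∑ i, ∑ j, v i * w j * hess n f x i j := by
  have hv (u : EuclideanSpace ℝ (Fin n)) :
      u = ∑ i, u i • (EuclideanSpace.single i (1 : ℝ) : EuclideanSpace ℝ (Fin n)) := by
    have := (EuclideanSpace.basisFun (Fin n) ℝ).sum_repr u
    simpa using this.symm
  conv_lhs => rw [hv v, hv w]
  simp only [map_sum, map_smul, _root_.sum_apply, smul_apply,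
    hess_apply hf, smul_eq_mul, Finset.mul_sum]
  rw [Finset.sum_comm]
  exact Finset.sum_congr rfl fun i _ => Finset.sum_congr rfl fun j _ => by ring

theorem meanCurv_eq (x : EuclideanSpace ℝ (Fin n)) :
    meanCurv n f x = (Real.sqrt (1 + gradSq n f x))⁻¹ *
      (∑ i, hess n f x i i -
        ∑ i, ∑ j, grad n f x i * grad n f x j / (1 + gradSq n f x) * hess n f x j i) / n := by
  simp [meanCurv, shapeOp, sub_mul, Matrix.trace, Matrix.mul_apply, ← Finset.mul_sum]

theorem grad_neg (x : EuclideanSpace ℝ (Fin n)) : grad n (-f) x = -grad n f x := by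
  ext i
  simp [grad, fderiv_neg]

theorem hess_neg (x : EuclideanSpace ℝ (Fin n)) : hess n (-f) x = -hess n f x := by
  ext i j
  simp only [hess, fderiv_neg, Matrix.of_apply, Matrix.neg_apply, neg_apply]
  rw [fderiv_fun_neg]
  simp

theorem meanCurv_neg (x : EuclideanSpace ℝ (Fin n)) : meanCurv n (-f) x = -meanCurv n f x := by
  simp [meanCurv_eq, gradSq, grad_neg, hess_neg]
  ring

theorem continuous_meanCurv (hf : ContDiff ℝ 2 f) : Continuous (meanCurv n f) := by
  have hg (i : Fin n) : Continuous fun x => grad n f x i :=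
    (hf.continuous_fderiv (by norm_num)).clm_apply continuous_const
  have hh (i j : Fin n) : Continuous fun x => hess n f x i j := by
    simp only [hess_apply hf]
    have : Continuous (fderiv ℝ (fderiv ℝ f)) :=
      (hf.fderiv_right (m := 1) (by norm_num)).continuous_fderiv (by norm_num)
    exact (this.clm_apply continuous_const).clm_apply continuous_const
  have hs : Continuous (gradSq n f) := by
    unfold gradSq
    fun_prop
  have hpos (x) : 0 < 1 + gradSq n f x := by
    have : 0 ≤ gradSq n f x := Finset.sum_nonneg fun i _ => sq_nonneg _
    linarith
  have hne (x) : 1 + gradSq n f x ≠ 0 := (hpos x).ne'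
  have hne' (x) : Real.sqrt (1 + gradSq n f x) ≠ 0 := (Real.sqrt_pos.2 (hpos x)).ne'
  rw [show meanCurv n f = _ from funext meanCurv_eq]
  fun_prop (disch := assumption)

end Derivatives

section Sphere

variable {E : Type*} [NormedAddCommGroup E] [InnerProductSpace ℝ E] {f : E → ℝ} {R : ℝ} {x : E}

theorem hasFDerivAt_sqrt_sq_sub_norm_sq (hx : 0 < R ^ 2 - ‖x‖ ^ 2) :
    HasFDerivAt (fun y : E => Real.sqrt (R ^ 2 - ‖y‖ ^ 2))
      (-(Real.sqrt (R ^ 2 - ‖x‖ ^ 2))⁻¹ • innerSL ℝ x) x := by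
  convert (((hasStrictFDerivAt_norm_sq x).hasFDerivAt).const_sub (R ^ 2)).sqrt hx.ne' using 1
  ext v
  simp
  ring

/-- If `f + √(R² - |·|²)` has a local maximum at `x`, then the gradient of `f` at `x` is that of
the lower hemisphere of radius `R`. -/
theorem fderiv_eq_of_isLocalMax_add_sqrt (hf : DifferentiableAt ℝ f x)
    (hx : 0 < R ^ 2 - ‖x‖ ^ 2)
    (hmax : IsLocalMax (fun y => f y + Real.sqrt (R ^ 2 - ‖y‖ ^ 2)) x) :
    fderiv ℝ f x = (Real.sqrt (R ^ 2 - ‖x‖ ^ 2))⁻¹ • innerSL ℝ x := by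
  have h := hmax.hasFDerivAt_eq_zero (hf.hasFDerivAt.add (hasFDerivAt_sqrt_sq_sub_norm_sq hx))
  rw [neg_smul, ← sub_eq_add_neg] at h
  exact sub_eq_zero.1 h

/-- If `f + √(R² - |·|²)` has a local maximum at `x`, then the second derivative of `f` at `x` is
bounded by that of the lower hemisphere of radius `R`. -/
theorem fderiv_fderiv_le_of_isLocalMax_add_sqrt (hf : ContDiff ℝ 2 f)
    (hx : 0 < R ^ 2 - ‖x‖ ^ 2)
    (hmax : IsLocalMax (fun y => f y + Real.sqrt (R ^ 2 - ‖y‖ ^ 2)) x) (v : E) :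
    fderiv ℝ (fderiv ℝ f) x v v ≤ ‖v‖ ^ 2 / Real.sqrt (R ^ 2 - ‖x‖ ^ 2) +
      inner ℝ x v ^ 2 / Real.sqrt (R ^ 2 - ‖x‖ ^ 2) ^ 3 := by
  have hline (t : ℝ) : HasDerivAt (fun t : ℝ => x + t • v) v t := by
    simpa using ((hasDerivAt_id t).smul_const v).const_add x
  have hcont : Continuous fun t : ℝ => x + t • v := by fun_prop
  have hnear : ∀ᶠ t : ℝ in nhds 0, 0 < R ^ 2 - ‖x + t • v‖ ^ 2 :=
    (show Continuous fun t : ℝ => R ^ 2 - ‖x + t • v‖ ^ 2 by fun_prop).continuousAt.eventually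
      (lt_mem_nhds (by simpa using hx))
  have hsqrt {t : ℝ} (ht : 0 < R ^ 2 - ‖x + t • v‖ ^ 2) :
      HasDerivAt (fun t : ℝ => Real.sqrt (R ^ 2 - ‖x + t • v‖ ^ 2))
        (-(Real.sqrt (R ^ 2 - ‖x + t • v‖ ^ 2))⁻¹ * inner ℝ (x + t • v) v) t := by
    exact (hasFDerivAt_sqrt_sq_sub_norm_sq ht).comp_hasDerivAt t (hline t)
  set g : ℝ → ℝ := fun t => f (x + t • v) + Real.sqrt (R ^ 2 - ‖x + t • v‖ ^ 2) with hg
  have hg' {t : ℝ} (ht : 0 < R ^ 2 - ‖x + t • v‖ ^ 2) : HasDerivAt g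
      (fderiv ℝ f (x + t • v) v +
        -(Real.sqrt (R ^ 2 - ‖x + t • v‖ ^ 2))⁻¹ * inner ℝ (x + t • v) v) t :=
    (((hf.differentiable (by norm_num) _).hasFDerivAt).comp_hasDerivAt t (hline t)).add (hsqrt ht)
  have hx₀ : 0 < R ^ 2 - ‖x + (0 : ℝ) • v‖ ^ 2 := by simpa using hx
  have hgmax : IsLocalMax g 0 := by
    have : Filter.Tendsto (fun t : ℝ => x + t • v) (nhds 0) (nhds x) := by
      simpa using hcont.tendsto 0
    have := this.eventually hmax
    simpa [IsLocalMax, IsMaxFilter, hg] using this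
  have hS : 0 < Real.sqrt (R ^ 2 - ‖x‖ ^ 2) := Real.sqrt_pos.2 hx
  have hg'' : HasDerivAt (deriv g) (fderiv ℝ (fderiv ℝ f) x v v -
      (‖v‖ ^ 2 / Real.sqrt (R ^ 2 - ‖x‖ ^ 2) +
        inner ℝ x v ^ 2 / Real.sqrt (R ^ 2 - ‖x‖ ^ 2) ^ 3)) 0 := by
    have heq : deriv g =ᶠ[nhds 0] fun t => fderiv ℝ f (x + t • v) v +
        -(Real.sqrt (R ^ 2 - ‖x + t • v‖ ^ 2))⁻¹ * inner ℝ (x + t • v) v := by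
      filter_upwards [hnear] with t ht using (hg' ht).deriv
    refine HasDerivAt.congr_of_eventuallyEq ?_ heq
    have hd : HasFDerivAt (fderiv ℝ f) (fderiv ℝ (fderiv ℝ f) (x + (0 : ℝ) • v))
        (x + (0 : ℝ) • v) :=
      ((hf.fderiv_right (m := 1) (by norm_num)).differentiable (by norm_num) _).hasFDerivAt
    have h₀ : HasDerivAt (fun t : ℝ => fderiv ℝ f (x + t • v))
        (fderiv ℝ (fderiv ℝ f) (x + (0 : ℝ) • v) v) 0 := hd.comp_hasDerivAt (0 : ℝ) (hline 0)
    have h₁ := h₀.clm_apply (hasDerivAt_const (0 : ℝ) v)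
    have h₂ := ((hsqrt hx₀).fun_inv (Real.sqrt_pos.2 hx₀).ne').fun_neg.fun_mul
      ((hline 0).inner ℝ (hasDerivAt_const (0 : ℝ) v))
    refine (h₁.fun_add h₂).congr_deriv ?_
    simp
    field_simp
    ring
  have := hgmax.deriv_deriv_nonpos (hg' hx₀).continuousAt
  rw [hg''.deriv] at this
  linarith

end Sphere

section Comparison

variable {n : ℕ} {f : EuclideanSpace ℝ (Fin n) → ℝ} {R : ℝ} {x : EuclideanSpace ℝ (Fin n)}

/-- A graph touching a lower hemisphere of radius `R` from below has mean curvature at most `1/R`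
at the contact point. -/
theorem meanCurv_le_of_isLocalMax_add_sqrt (hn : 0 < n) (hR : 0 < R) (hf : ContDiff ℝ 2 f)
    (hx : 0 < R ^ 2 - ‖x‖ ^ 2)
    (hmax : IsLocalMax (fun y => f y + Real.sqrt (R ^ 2 - ‖y‖ ^ 2)) x) :
    meanCurv n f x ≤ 1 / R := by
  set s := Real.sqrt (R ^ 2 - ‖x‖ ^ 2) with hs
  have hs0 : 0 < s := Real.sqrt_pos.2 hx
  have hs2 : s ^ 2 = R ^ 2 - ‖x‖ ^ 2 := Real.sq_sqrt hx.le
  have hnorm : ∑ i, x i ^ 2 = ‖x‖ ^ 2 := (EuclideanSpace.real_norm_sq_eq x).symm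
  have hgrad (i : Fin n) : grad n f x i = x i / s := by
    rw [grad, fderiv_eq_of_isLocalMax_add_sqrt (hf.differentiable (by norm_num) x) hx hmax, ← hs]
    simp [EuclideanSpace.inner_single_right]
    ring
  have hgradSq : 1 + gradSq n f x = (R / s) ^ 2 := by
    simp only [gradSq, hgrad, div_pow, ← Finset.sum_div, hnorm]
    field_simp
    linarith
  set c := 1 / (R * (R + s)) with hc
  let v (k : Fin n) : EuclideanSpace ℝ (Fin n) := EuclideanSpace.single k 1 - (c * x k) • x
  have hcx : c * ‖x‖ ^ 2 = 1 - s / R := by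
    rw [hc, show ‖x‖ ^ 2 = (R - s) * (R + s) by linarith]
    field_simp
  have hc2 : 2 * c - c ^ 2 * ‖x‖ ^ 2 = 1 / R ^ 2 := by
    rw [show c ^ 2 * ‖x‖ ^ 2 = c * (c * ‖x‖ ^ 2) by ring, hcx, hc]
    field_simp
    ring
  have hinner (k : Fin n) : inner ℝ x (v k) = x k * (s / R) := by
    simp only [v, inner_sub_right, inner_smul_right, real_inner_self_eq_norm_sq,
      EuclideanSpace.inner_single_right]
    simp
    linear_combination -x k * hcx
  have hvnorm (k : Fin n) : ‖v k‖ ^ 2 = 1 - x k ^ 2 / R ^ 2 := by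
    have : ‖v k‖ ^ 2 = 1 - 2 * c * x k ^ 2 + c ^ 2 * x k ^ 2 * ‖x‖ ^ 2 := by
      simp only [v, norm_sub_sq_real, norm_smul, inner_smul_right, mul_pow,
        EuclideanSpace.inner_single_left, Real.norm_eq_abs, sq_abs]
      simp
      ring
    rw [this]
    linear_combination -x k ^ 2 * hc2
  have htrace : ∑ k, fderiv ℝ (fderiv ℝ f) x (v k) (v k) =
      ∑ i, hess n f x i i - ∑ i, ∑ j, x i * x j / R ^ 2 * hess n f x j i := by
    set B := fderiv ℝ (fderiv ℝ f) x
    have hxB : (∑ k, x k • (EuclideanSpace.single k (1 : ℝ) : EuclideanSpace ℝ (Fin n))) = x := by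
      simpa using (EuclideanSpace.basisFun (Fin n) ℝ).sum_repr x
    have h₁ : ∑ k, x k * B x (EuclideanSpace.single k 1) = B x x := by
      simpa using congrArg (B x) hxB
    have h₂ : ∑ k, x k * B (EuclideanSpace.single k 1) x = B x x := by
      have := congrArg (fun u => B u x) hxB
      simpa using this
    have h₃ : ∑ i, ∑ j, x i * x j / R ^ 2 * hess n f x j i = B x x / R ^ 2 := by
      rw [fderiv_fderiv_apply_eq_sum_hess hf, Finset.sum_comm, Finset.sum_div]
      refine Finset.sum_congr rfl fun i _ => ?_
      rw [Finset.sum_div]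
      exact Finset.sum_congr rfl fun j _ => by ring
    have h₄ (k : Fin n) : B (v k) (v k) = hess n f x k k -
        c * (x k * B x (EuclideanSpace.single k 1)) - c * (x k * B (EuclideanSpace.single k 1) x)
        + c ^ 2 * B x x * x k ^ 2 := by
      simp only [v, hess_apply hf, map_sub, map_smul, sub_apply,
        smul_apply, smul_eq_mul, B]
      ring
    simp only [h₄, Finset.sum_add_distrib, Finset.sum_sub_distrib, ← Finset.mul_sum, h₁, h₂, h₃,
      hnorm]
    linear_combination -B x x * hc2
  have hle : ∑ k, fderiv ℝ (fderiv ℝ f) x (v k) (v k) ≤ n / s := by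
    refine (Finset.sum_le_sum fun k _ =>
      fderiv_fderiv_le_of_isLocalMax_add_sqrt hf hx hmax (v k)).trans_eq ?_
    simp only [← hs, hinner, hvnorm, Finset.sum_add_distrib, ← Finset.sum_div, mul_pow,
      Finset.sum_sub_distrib, ← Finset.sum_mul, hnorm]
    simp
    field_simp
    ring
  have hn' : (0 : ℝ) < n := Nat.cast_pos.2 hn
  have hsum : ∑ i, ∑ j, grad n f x i * grad n f x j / (R / s) ^ 2 * hess n f x j i =
      ∑ i, ∑ j, x i * x j / R ^ 2 * hess n f x j i := by
    refine Finset.sum_congr rfl fun i _ => Finset.sum_congr rfl fun j _ => ?_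
    rw [hgrad, hgrad]
    field_simp
  rw [meanCurv_eq, hgradSq, Real.sqrt_sq (by positivity), hsum, ← htrace]
  calc (R / s)⁻¹ * (∑ k, fderiv ℝ (fderiv ℝ f) x (v k) (v k)) / n
      ≤ (R / s)⁻¹ * (n / s) / n := by gcongr
    _ = 1 / R := by field_simp

theorem exists_meanCurv_lt {r : ℝ} (hn : 0 < n) (hr : 0 < r) (hf : ContDiff ℝ 2 f) :
    ∃ x ∈ closedBall (0 : EuclideanSpace ℝ (Fin n)) r, meanCurv n f x < 1 / r := by
  have hcompact := isCompact_closedBall (0 : EuclideanSpace ℝ (Fin n)) r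
  obtain ⟨K, hK⟩ := hcompact.exists_bound_of_continuousOn
    (hf.continuous_fderiv (by norm_num)).continuousOn
  have hK0 : 0 ≤ K := (norm_nonneg _).trans (hK 0 (by simpa using hr.le))
  set δ := r / (K + 1) with hδ
  have hδ0 : 0 < δ := by positivity
  set R := Real.sqrt (r ^ 2 + δ ^ 2)
  have hR2 : R ^ 2 = r ^ 2 + δ ^ 2 := Real.sq_sqrt (by positivity)
  have hrR : r < R := Real.lt_sqrt_of_sq_lt (by nlinarith)
  obtain ⟨x, hx, hmax⟩ := hcompact.exists_isMaxOn ⟨0, by simpa using hr.le⟩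
    (f := fun y => f y + Real.sqrt (R ^ 2 - ‖y‖ ^ 2))
    (hf.continuous.add (by fun_prop)).continuousOn
  have hxr : ‖x‖ ≤ r := by simpa using hx
  have hxR : 0 < R ^ 2 - ‖x‖ ^ 2 := by nlinarith [norm_nonneg x]
  refine ⟨x, hx, ?_⟩
  rcases hxr.lt_or_eq with hlt | heq
  · have hloc := hmax.isLocalMax (Filter.mem_of_superset
      (isOpen_ball.mem_nhds (by simpa using hlt)) ball_subset_closedBall)
    exact (meanCurv_le_of_isLocalMax_add_sqrt hn (hr.trans hrR) hf hxR hloc).trans_lt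
      (one_div_lt_one_div_of_lt hr hrR)
  · exfalso
    have hd := ((hf.differentiable (by norm_num) x).hasFDerivAt.add
      (hasFDerivAt_sqrt_sq_sub_norm_sq hxR)).hasFDerivWithinAt
        (s := closedBall (0 : EuclideanSpace ℝ (Fin n)) r)
    have hcone : -x ∈ posTangentConeAt (closedBall (0 : EuclideanSpace ℝ (Fin n)) r) x := by
      refine mem_posTangentConeAt_of_segment_subset
        ((convex_closedBall _ _).segment_subset hx ?_)
      simpa using hr.le
    have hle := hmax.localize.hasFDerivWithinAt_nonpos hd hcone
    have hs : Real.sqrt (R ^ 2 - ‖x‖ ^ 2) = δ := by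
      rw [hR2, heq, add_sub_cancel_left, Real.sqrt_sq hδ0.le]
    rw [hs] at hle
    simp [heq] at hle
    have hbound : fderiv ℝ f x x ≤ K * r :=
      (le_abs_self _).trans (((fderiv ℝ f x).le_opNorm x).trans
        (by rw [heq]; exact mul_le_mul_of_nonneg_right (hK x hx) hr.le))
    have : δ⁻¹ * r ^ 2 = (K + 1) * r := by
      rw [hδ]
      field_simp
    linarith

end Comparison

/-- **Heinz–Chern–Flanders estimate, strict version (Theorem 1).**
If `M` is a graph over the closed ball of radius `r` in `ℝⁿ`, `n ≥ 2`,
then `inf |H| < 1/r`. -/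
theorem inf_meanCurv_lt_of_graph_closedBall
    (n : ℕ) (hn : 2 ≤ n) (r : ℝ) (hr : 0 < r)
    (f : EuclideanSpace ℝ (Fin n) → ℝ) (hf : ContDiff ℝ 2 f) :
    sInf ((fun x => |meanCurv n f x|) '' closedBall (0 : EuclideanSpace ℝ (Fin n)) r)
      < 1 / r := by
  suffices ∃ x ∈ closedBall (0 : EuclideanSpace ℝ (Fin n)) r, |meanCurv n f x| < 1 / r by
    obtain ⟨x, hx, hlt⟩ := this
    refine (csInf_le ⟨0, ?_⟩ (Set.mem_image_of_mem _ hx)).trans_lt hlt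
    rintro _ ⟨y, -, rfl⟩
    exact abs_nonneg _
  by_contra! hge
  have hr' : 0 < 1 / r := by positivity
  obtain ⟨x, hx, hxlt⟩ := exists_meanCurv_lt (by lia) hr hf
  obtain ⟨y, hy, hylt⟩ := exists_meanCurv_lt (by lia) hr hf.neg
  have hyneg : meanCurv n (-f) y < 1 / r := hylt
  rw [meanCurv_neg] at hyneg
  have hx0 : meanCurv n f x ≤ 0 := by
    rcases le_abs.1 (hge x hx) with h | h <;> linarith
  have hy0 : 0 ≤ meanCurv n f y := by
    rcases le_abs.1 (hge y hy) with h | h <;> linarith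
  obtain ⟨z, hz, hz0⟩ := (convex_closedBall (0 : EuclideanSpace ℝ (Fin n)) r).isPreconnected
    |>.intermediate_value hx hy (continuous_meanCurv hf).continuousOn ⟨hx0, hy0⟩
  have := hge z hz
  rw [hz0, abs_zero] at this
  linarith
end

section
/- Let n ≥ 2, r > 0, and let f be a C² real-valued function on the closed ball B̄_r ⊂ ℝⁿ. If there exists a point q ∈ B̄_r at which the Hessian matrix D²f(q) is semi-definite (either positive semidefinite or negative semidefinite), then inf_{x∈B̄_r} |R(x)| < 1/r². -/
open Metric Finset

section MatrixLemmas

open Matrix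

open scoped MatrixOrder in
theorem Matrix.PosSemidef.exists_eq_transpose_mul_self {n : Type*} [Fintype n] [DecidableEq n]
    {P : Matrix n n ℝ}
    (hP : P.PosSemidef) : ∃ C : Matrix n n ℝ, P = Cᵀ * C := by
  obtain ⟨C, hC⟩ := CStarAlgebra.nonneg_iff_eq_star_mul_self.mp hP.nonneg
  exact ⟨C, by simpa [star_eq_conjTranspose, conjTranspose_eq_transpose_of_trivial] using hC⟩

theorem Matrix.IsSymm.trace_sq_le {n : Type*} [Fintype n] {S : Matrix n n ℝ} (hS : S.IsSymm) :
    S.trace ^ 2 ≤ Fintype.card n * (S * S).trace := by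
  have h1 : (S * S).trace = ∑ i, ∑ j, S i j ^ 2 := by
    simp only [trace, diag, mul_apply]
    refine Finset.sum_congr rfl fun i _ => Finset.sum_congr rfl fun j _ => ?_
    rw [hS.apply i j, sq]
  have h2 : S.trace ^ 2 ≤ Fintype.card n * ∑ i, S i i ^ 2 := by
    simpa [trace] using sq_sum_le_card_mul_sum_sq (s := Finset.univ) (f := fun i => S i i)
  refine h2.trans (mul_le_mul_of_nonneg_left ?_ (Nat.cast_nonneg _))
  rw [h1]
  exact Finset.sum_le_sum fun i _ =>
    Finset.single_le_sum (f := fun j => S i j ^ 2) (fun j _ => sq_nonneg _) (Finset.mem_univ i)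

theorem Matrix.PosSemidef.trace_mul_self_le {n : Type*} [Fintype n] [DecidableEq n]
    {S : Matrix n n ℝ}
    (hS : S.PosSemidef) : (S * S).trace ≤ S.trace ^ 2 := by
  obtain ⟨D, rfl⟩ := hS.exists_eq_transpose_mul_self
  have h (i j) : (Dᵀ * D) i j * (Dᵀ * D) j i ≤ (Dᵀ * D) i i * (Dᵀ * D) j j := by
    have := Finset.sum_mul_sq_le_sq_mul_sq Finset.univ (fun k => D k i) (fun k => D k j)
    simp only [mul_apply, transpose_apply]
    calc _ = (∑ k, D k i * D k j) ^ 2 := by simp only [sq, mul_comm]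
      _ ≤ _ := by simpa only [sq] using this
  rw [sq, trace, trace, Finset.sum_mul_sum]
  simp only [diag]
  refine Finset.sum_le_sum fun i _ => ?_
  rw [mul_apply]
  exact Finset.sum_le_sum fun j _ => h i j

/-- For `P` positive semidefinite, `P * A` and its square have the same traces as a matrix of
the form `C * A * Cᵀ` and its square. -/
theorem Matrix.PosSemidef.exists_congruent {n : Type*} [Fintype n] [DecidableEq n]
    {P : Matrix n n ℝ} (hP : P.PosSemidef) (A : Matrix n n ℝ) :
    ∃ C : Matrix n n ℝ, (P * A).trace = (C * A * Cᵀ).trace ∧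
      (P * A * (P * A)).trace = (C * A * Cᵀ * (C * A * Cᵀ)).trace := by
  obtain ⟨C, rfl⟩ := hP.exists_eq_transpose_mul_self
  refine ⟨C, ?_, ?_⟩
  · rw [Matrix.mul_assoc, trace_mul_comm]
  · rw [Matrix.mul_assoc, Matrix.mul_assoc, trace_mul_comm]
    simp only [Matrix.mul_assoc]

theorem Matrix.PosSemidef.trace_mul_nonneg {n : Type*} [Fintype n] [DecidableEq n]
    {P A : Matrix n n ℝ} (hP : P.PosSemidef) (hA : A.PosSemidef) : 0 ≤ (P * A).trace := by
  obtain ⟨C, hC, -⟩ := hP.exists_congruent A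
  rw [hC]
  simpa using (hA.mul_mul_conjTranspose_same C).trace_nonneg

theorem Matrix.PosSemidef.trace_mul_sq_le {n : Type*} [Fintype n] [DecidableEq n]
    {P A : Matrix n n ℝ} (hP : P.PosSemidef) (hA : A.IsSymm) :
    (P * A).trace ^ 2 ≤ Fintype.card n * (P * A * (P * A)).trace := by
  obtain ⟨C, h₁, h₂⟩ := hP.exists_congruent A
  rw [h₁, h₂]
  exact IsSymm.trace_sq_le (by simp [IsSymm, hA.eq, Matrix.mul_assoc])

theorem Matrix.PosSemidef.trace_mul_mul_self_le {n : Type*} [Fintype n] [DecidableEq n]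
    {P A : Matrix n n ℝ} (hP : P.PosSemidef) (hA : A.PosSemidef) :
    (P * A * (P * A)).trace ≤ (P * A).trace ^ 2 := by
  obtain ⟨C, h₁, h₂⟩ := hP.exists_congruent A
  rw [h₁, h₂]
  exact PosSemidef.trace_mul_self_le (by simpa using hA.mul_mul_conjTranspose_same C)

/-- `I - u uᵀ / (1 + |u|²)`, the inverse of the metric of a graph with gradient `u`. -/
theorem Matrix.posSemidef_one_sub_vecMulVec_div {n : Type*} [Fintype n] [DecidableEq n]
    (u : n → ℝ) :
    ((1 : Matrix n n ℝ) -
      Matrix.of fun i j => u i * u j / (1 + ∑ k, u k ^ 2)).PosSemidef := by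
  have hg : 0 ≤ ∑ k, u k ^ 2 := Finset.sum_nonneg fun _ _ => sq_nonneg _
  refine .of_dotProduct_mulVec_nonneg ?_ fun v => ?_
  · ext i j
    simp [one_apply, eq_comm, mul_comm]
  have h1 : (Matrix.of fun i j => u i * u j / (1 + ∑ k, u k ^ 2)) *ᵥ v
      = ((∑ j, u j * v j) / (1 + ∑ k, u k ^ 2)) • u := by
    ext i
    simp only [mulVec, dotProduct, of_apply, Pi.smul_apply, smul_eq_mul, Finset.sum_div,
      Finset.sum_mul]
    refine Finset.sum_congr rfl fun j _ => by ring
  have h2 := Finset.sum_mul_sq_le_sq_mul_sq Finset.univ u v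
  have hv : 0 ≤ ∑ k, v k ^ 2 := Finset.sum_nonneg fun _ _ => sq_nonneg _
  rw [sub_mulVec, h1, one_mulVec, dotProduct_sub, dotProduct_smul]
  simp only [dotProduct, star_trivial, smul_eq_mul]
  have e1 : ∑ i, v i * v i = ∑ i, v i ^ 2 := by simp only [sq]
  have e2 : ∑ i, v i * u i = ∑ i, u i * v i := by simp only [mul_comm]
  rw [e1, e2, sub_nonneg, div_mul_eq_mul_div, div_le_iff₀ (by linarith)]
  nlinarith

end MatrixLemmas

/-- The second derivative of a real function is nonpositive at a local maximum. -/
theorem IsLocalMax.hasDerivAt_deriv_nonpos {φ φ' : ℝ → ℝ} {a c : ℝ} (h : IsLocalMax φ a)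
    (hφ : ∀ᶠ t in nhds a, HasDerivAt φ (φ' t) t) (hφ' : HasDerivAt φ' c a) : c ≤ 0 := by
  by_contra! hc
  have h1 : deriv φ =ᶠ[nhds a] φ' := hφ.mono fun t ht => ht.deriv
  have h2 : deriv (deriv φ) a = c := by rw [h1.deriv_eq, hφ'.deriv]
  have h3 := isLocalMin_of_deriv_deriv_pos (h2 ▸ hc) h.deriv_eq_zero
    hφ.self_of_nhds.continuousAt
  have h4 : φ =ᶠ[nhds a] fun _ => φ a := by
    filter_upwards [h, h3] with t ht ht' using le_antisymm ht ht'
  have h5 : deriv φ =ᶠ[nhds a] fun _ => 0 := by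
    simpa using h4.deriv
  rw [h5.deriv_eq] at h2
  simp at h2
  linarith

section Hessian

variable {n : ℕ} {f : EuclideanSpace ℝ (Fin n) → ℝ}

theorem hess_isSymm (hf : ContDiff ℝ 2 f) (x : EuclideanSpace ℝ (Fin n)) :
    (hess n f x).IsSymm := by
  ext i j
  rw [Matrix.transpose_apply, hess_apply hf, hess_apply hf]
  exact (hf.contDiffAt.isSymmSndFDerivAt (by simp)).eq _ _

theorem EuclideanSpace.toLp_eq_sum_single (v : Fin n → ℝ) :
    WithLp.toLp 2 v = ∑ i, v i • EuclideanSpace.single i (1 : ℝ) := by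
  ext j
  simp [Pi.single_apply]

theorem dotProduct_hess_mulVec (hf : ContDiff ℝ 2 f) (x : EuclideanSpace ℝ (Fin n))
    (v : Fin n → ℝ) :
    v ⬝ᵥ Matrix.mulVec (hess n f x) v =
      fderiv ℝ (fderiv ℝ f) x (WithLp.toLp 2 v) (WithLp.toLp 2 v) := by
  rw [EuclideanSpace.toLp_eq_sum_single]
  simp only [map_sum, map_smul, _root_.sum_apply, smul_apply,
    smul_eq_mul, dotProduct, Matrix.mulVec, hess_apply hf, Finset.mul_sum]
  rw [Finset.sum_comm]
  refine Finset.sum_congr rfl fun i _ => Finset.sum_congr rfl fun j _ => by ring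

theorem continuous_grad (hf : ContDiff ℝ 2 f) (i : Fin n) :
    Continuous fun x => grad n f x i :=
  (hf.continuous_fderiv (by norm_num)).clm_apply continuous_const

theorem continuous_hess (hf : ContDiff ℝ 2 f) : Continuous fun x => hess n f x := by
  refine continuous_matrix fun i j => ?_
  simp only [hess_apply hf]
  have h : Continuous (fderiv ℝ (fderiv ℝ f)) :=
    (hf.fderiv_right (m := 1) (by norm_num)).continuous_fderiv (by norm_num)
  exact (h.clm_apply continuous_const).clm_apply continuous_const

theorem gradSq_nonneg (x : EuclideanSpace ℝ (Fin n)) : 0 ≤ gradSq n f x :=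
  Finset.sum_nonneg fun _ _ => sq_nonneg _

theorem continuous_shapeOp (hf : ContDiff ℝ 2 f) : Continuous fun x => shapeOp n f x := by
  have hg : Continuous fun x => gradSq n f x :=
    continuous_finsetSum _ fun i _ => (continuous_grad hf i).pow 2
  have hpos (x) : 0 < 1 + gradSq n f x := by linarith [gradSq_nonneg (f := f) x]
  have hM : Continuous fun x =>
      (Matrix.of fun i j => grad n f x i * grad n f x j / (1 + gradSq n f x) :
        Matrix (Fin n) (Fin n) ℝ) :=
    continuous_matrix fun i j => ((continuous_grad hf i).mul (continuous_grad hf j)).div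
      (continuous_const.add hg) fun x => (hpos x).ne'
  have hk : Continuous fun x => (Real.sqrt (1 + gradSq n f x))⁻¹ :=
    (continuous_const.add hg).sqrt.inv₀ fun x => (Real.sqrt_pos.2 (hpos x)).ne'
  exact hk.smul ((continuous_const.sub hM).matrix_mul (continuous_hess hf))

theorem continuous_scalarCurv (hf : ContDiff ℝ 2 f) : Continuous fun x => scalarCurv n f x := by
  have h := continuous_shapeOp hf
  exact ((h.matrix_trace.pow 2).sub (h.matrix_mul h).matrix_trace).div_const _

theorem shapeOp_neg (x : EuclideanSpace ℝ (Fin n)) : shapeOp n (-f) x = -shapeOp n f x := by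
  simp [shapeOp, gradSq, grad_neg, hess_neg]

theorem scalarCurv_neg (x : EuclideanSpace ℝ (Fin n)) :
    scalarCurv n (-f) x = scalarCurv n f x := by
  simp [scalarCurv, shapeOp_neg]

/-- The inverse metric factor of the shape operator. -/
theorem posSemidef_inverseMetric (x : EuclideanSpace ℝ (Fin n)) :
    ((1 : Matrix (Fin n) (Fin n) ℝ) -
      Matrix.of fun i j => grad n f x i * grad n f x j / (1 + gradSq n f x)).PosSemidef :=
  Matrix.posSemidef_one_sub_vecMulVec_div _

theorem scalarCurv_le (hn : 2 ≤ n) (hf : ContDiff ℝ 2 f) (x : EuclideanSpace ℝ (Fin n)) :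
    scalarCurv n f x ≤ ((shapeOp n f x).trace / n) ^ 2 := by
  have h := (posSemidef_inverseMetric (f := f) x).trace_mul_sq_le (hess_isSymm hf x)
  have hk := mul_le_mul_of_nonneg_left h (sq_nonneg (Real.sqrt (1 + gradSq n f x))⁻¹)
  have hT : (shapeOp n f x).trace ^ 2 ≤ n * (shapeOp n f x * shapeOp n f x).trace := by
    simp only [shapeOp, Matrix.trace_smul, Matrix.smul_mul, Matrix.mul_smul, smul_eq_mul]
    rw [Fintype.card_fin] at hk
    linarith
  have hn' : (2 : ℝ) ≤ n := by exact_mod_cast hn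
  rw [scalarCurv, div_pow, div_le_div_iff₀ (by nlinarith) (by positivity)]
  nlinarith

theorem scalarCurv_nonneg (hn : 2 ≤ n) {x : EuclideanSpace ℝ (Fin n)}
    (hx : (hess n f x).PosSemidef) : 0 ≤ scalarCurv n f x := by
  have h := (posSemidef_inverseMetric (f := f) x).trace_mul_mul_self_le hx
  have hk := mul_le_mul_of_nonneg_left h (sq_nonneg (Real.sqrt (1 + gradSq n f x))⁻¹)
  have hn' : (2 : ℝ) ≤ n := by exact_mod_cast hn
  refine div_nonneg ?_ (by nlinarith)
  simp only [shapeOp, Matrix.trace_smul, Matrix.smul_mul, Matrix.mul_smul, smul_eq_mul]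
  linarith

end Hessian

section Touching

variable {E : Type*} [NormedAddCommGroup E] [InnerProductSpace ℝ E] {ρ : ℝ}

theorem hasFDerivAt_sqrt_sub_norm_sq {x : E} (hx : 0 < ρ ^ 2 - ‖x‖ ^ 2) :
    HasFDerivAt (fun y : E => Real.sqrt (ρ ^ 2 - ‖y‖ ^ 2))
      (-(Real.sqrt (ρ ^ 2 - ‖x‖ ^ 2))⁻¹ • innerSL ℝ x) x := by
  refine ((((hasFDerivAt_id x).norm_sq).const_sub (ρ ^ 2)).sqrt hx.ne').congr_fderiv ?_
  ext v
  simp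
  ring

/-- If `f + √(ρ² - |x|²)` has a local maximum at `x`, the Hessian of `f` is bounded by that of
the lower hemisphere of radius `ρ`. -/
theorem fderiv_fderiv_le_of_isLocalMax {f : E → ℝ} (hf : ContDiff ℝ 2 f) {x : E}
    (hx : 0 < ρ ^ 2 - ‖x‖ ^ 2)
    (h : IsLocalMax (fun y => f y + Real.sqrt (ρ ^ 2 - ‖y‖ ^ 2)) x) (v : E) :
    fderiv ℝ (fderiv ℝ f) x v v ≤
      ‖v‖ ^ 2 / Real.sqrt (ρ ^ 2 - ‖x‖ ^ 2) +
        inner ℝ x v ^ 2 / Real.sqrt (ρ ^ 2 - ‖x‖ ^ 2) ^ 3 := by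
  have hl (t : ℝ) : HasDerivAt (fun t : ℝ => x + t • v) v t := by
    simpa using ((hasDerivAt_id t).smul_const v).const_add x
  have hl0 : Filter.Tendsto (fun t : ℝ => x + t • v) (nhds 0) (nhds x) := by
    simpa using (hl 0).continuousAt.tendsto
  have hpos : ∀ᶠ t : ℝ in nhds 0, 0 < ρ ^ 2 - ‖x + t • v‖ ^ 2 :=
    hl0.eventually ((continuous_const.sub (continuous_norm.pow 2)).continuousAt.eventually
      (lt_mem_nhds hx))
  have hmax : IsLocalMax (fun t : ℝ => f (x + t • v) + Real.sqrt (ρ ^ 2 - ‖x + t • v‖ ^ 2)) 0 := by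
    have hev := hl0.eventually h
    simpa only [IsLocalMax, IsMaxFilter, zero_smul, add_zero] using hev
  have hdf : Differentiable ℝ f := hf.differentiable (by norm_num)
  have hd2 : Differentiable ℝ (fderiv ℝ f) :=
    (hf.fderiv_right (m := 1) (by norm_num)).differentiable (by norm_num)
  have h1 : ∀ᶠ t : ℝ in nhds 0,
      HasDerivAt (fun τ : ℝ => f (x + τ • v) + Real.sqrt (ρ ^ 2 - ‖x + τ • v‖ ^ 2))
        (fderiv ℝ f (x + t • v) v -
          inner ℝ (x + t • v) v / Real.sqrt (ρ ^ 2 - ‖x + t • v‖ ^ 2)) t := by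
    filter_upwards [hpos] with t ht
    refine (((hdf _).hasFDerivAt.comp_hasDerivAt t (hl t)).add
      ((hasFDerivAt_sqrt_sub_norm_sq ht).comp_hasDerivAt t (hl t))).congr_deriv ?_
    simp only [smul_apply, innerSL_apply_apply, smul_eq_mul]
    ring
  have hx' : 0 < ρ ^ 2 - ‖x + (0 : ℝ) • v‖ ^ 2 := by simpa using hx
  have hs : 0 < Real.sqrt (ρ ^ 2 - ‖x‖ ^ 2) := Real.sqrt_pos.2 hx
  have hA : HasDerivAt (fun t : ℝ => fderiv ℝ f (x + t • v) v) (fderiv ℝ (fderiv ℝ f) x v v) 0 := by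
    have hL : HasDerivAt (fun t : ℝ => fderiv ℝ f (x + t • v)) (fderiv ℝ (fderiv ℝ f) x v) 0 :=
      (hd2 x).hasFDerivAt.comp_hasDerivAt_of_eq (0 : ℝ) (hl 0) (by simp)
    exact (hL.clm_apply (hasDerivAt_const (0 : ℝ) v)).congr_deriv (by simp)
  have hB : HasDerivAt (fun t : ℝ => inner ℝ (x + t • v) v) (‖v‖ ^ 2) 0 := by
    simpa using (hl 0).inner ℝ (hasDerivAt_const (0 : ℝ) v)
  have hC : HasDerivAt (fun t : ℝ => Real.sqrt (ρ ^ 2 - ‖x + t • v‖ ^ 2))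
      (-(Real.sqrt (ρ ^ 2 - ‖x‖ ^ 2))⁻¹ * inner ℝ x v) 0 := by
    have := (hasFDerivAt_sqrt_sub_norm_sq hx').comp_hasDerivAt (0 : ℝ) (hl 0)
    refine this.congr_deriv ?_
    simp
  have h2 := hmax.hasDerivAt_deriv_nonpos h1 (hA.sub (hB.div hC (by simpa using hs.ne')))
  simp only [zero_smul, add_zero] at h2
  refine (sub_nonpos.1 h2).trans (le_of_eq ?_)
  field_simp
  ring

theorem fderiv_eq_of_isLocalMax {f : E → ℝ} {x : E} (hf : DifferentiableAt ℝ f x)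
    (hx : 0 < ρ ^ 2 - ‖x‖ ^ 2)
    (h : IsLocalMax (fun y => f y + Real.sqrt (ρ ^ 2 - ‖y‖ ^ 2)) x) :
    fderiv ℝ f x = (Real.sqrt (ρ ^ 2 - ‖x‖ ^ 2))⁻¹ • innerSL ℝ x := by
  have := h.hasFDerivAt_eq_zero (hf.hasFDerivAt.add (hasFDerivAt_sqrt_sub_norm_sq hx))
  rw [neg_smul, ← sub_eq_add_neg, sub_eq_zero] at this
  exact this

/-- A sphere of radius slightly larger than `r`, whose slope on the sphere of radius `r` exceeds
that of `f`, touches the graph of `f` from above over an interior point of the ball. -/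
theorem exists_isLocalMax_add_sqrt [FiniteDimensional ℝ E] {f : E → ℝ} (hf : ContDiff ℝ 2 f)
    {r : ℝ} (hr : 0 < r) :
    ∃ ρ > r, ∃ x ∈ ball (0 : E) r,
      IsLocalMax (fun y => f y + Real.sqrt (ρ ^ 2 - ‖y‖ ^ 2)) x := by
  have hc : IsCompact (closedBall (0 : E) r) := isCompact_closedBall _ _
  obtain ⟨M, hM⟩ := hc.exists_bound_of_continuousOn
    (hf.continuous_fderiv (by norm_num)).continuousOn
  have hM0 : 0 ≤ M := (norm_nonneg _).trans (hM 0 (mem_closedBall_self hr.le))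
  set s := r / (M + 1) with hs
  have hs0 : 0 < s := by positivity
  set ρ := Real.sqrt (r ^ 2 + s ^ 2) with hρ
  have hρ2 : ρ ^ 2 = r ^ 2 + s ^ 2 := Real.sq_sqrt (by positivity)
  have hρr : r < ρ := Real.lt_sqrt_of_sq_lt (by nlinarith)
  obtain ⟨x, hx, hmax⟩ := hc.exists_isMaxOn ⟨0, mem_closedBall_self hr.le⟩
    (f := fun y => f y + Real.sqrt (ρ ^ 2 - ‖y‖ ^ 2))
    (hf.continuous.add (continuous_const.sub (continuous_norm.pow 2)).sqrt).continuousOn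
  have hxr : ‖x‖ < r := by
    by_contra! hge
    have hxr : ‖x‖ = r := le_antisymm (by simpa using hx) hge
    have hpos : ρ ^ 2 - ‖x‖ ^ 2 = s ^ 2 := by rw [hρ2, hxr]; ring
    have hcone : (0 : E) - x ∈ posTangentConeAt (closedBall (0 : E) r) x :=
      sub_mem_posTangentConeAt_of_segment_subset
        ((convex_closedBall _ _).segment_subset hx (mem_closedBall_self hr.le))
    have hd := ((hf.differentiable (by norm_num)) x).hasFDerivAt.add
      (hasFDerivAt_sqrt_sub_norm_sq (x := x) (ρ := ρ) (by rw [hpos]; positivity))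
    have h := hmax.localize.hasFDerivWithinAt_nonpos hd.hasFDerivWithinAt hcone
    rw [hpos, Real.sqrt_sq hs0.le] at h
    simp [hxr] at h
    have hb : fderiv ℝ f x x ≤ M * r :=
      (le_abs_self _).trans (((fderiv ℝ f x).le_of_opNorm_le (hM x hx) x).trans_eq (by rw [hxr]))
    have he : s⁻¹ * r ^ 2 = (M + 1) * r := by rw [hs]; field_simp
    nlinarith
  refine ⟨ρ, hρr, x, by simpa using hxr, ?_⟩
  exact hmax.isLocalMax (Filter.mem_of_superset
    (isOpen_ball.mem_nhds (by simpa using hxr)) ball_subset_closedBall)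

end Touching

theorem exists_trace_shapeOp_lt {n : ℕ} (hn : 0 < n) {r : ℝ} (hr : 0 < r)
    {f : EuclideanSpace ℝ (Fin n) → ℝ} (hf : ContDiff ℝ 2 f) :
    ∃ x ∈ closedBall (0 : EuclideanSpace ℝ (Fin n)) r, (shapeOp n f x).trace < n / r := by
  obtain ⟨ρ, hρ, x, hx, hmax⟩ := exists_isLocalMax_add_sqrt hf hr
  refine ⟨x, ball_subset_closedBall hx, ?_⟩
  have hxr : ‖x‖ < r := by simpa using hx
  have hpos : 0 < ρ ^ 2 - ‖x‖ ^ 2 := by nlinarith [norm_nonneg x]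
  have hfd := fderiv_eq_of_isLocalMax ((hf.differentiable (by norm_num)) x) hpos hmax
  have hsnd := fderiv_fderiv_le_of_isLocalMax hf hpos hmax
  set s := Real.sqrt (ρ ^ 2 - ‖x‖ ^ 2) with hs
  have hs0 : 0 < s := Real.sqrt_pos.2 hpos
  have hs2 : s ^ 2 = ρ ^ 2 - ‖x‖ ^ 2 := Real.sq_sqrt hpos.le
  have hgrad (i) : grad n f x i = x i / s := by
    simp [grad, hfd, EuclideanSpace.inner_single_right]
    ring
  have hnorm : ∑ i, x i ^ 2 = ‖x‖ ^ 2 := by rw [EuclideanSpace.real_norm_sq_eq]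
  have hgs : gradSq n f x = ‖x‖ ^ 2 / s ^ 2 := by
    simp only [gradSq, hgrad, div_pow, ← Finset.sum_div, hnorm]
  have h1g : 1 + gradSq n f x = (ρ / s) ^ 2 := by
    rw [hgs, div_pow]
    field_simp
    linarith
  have hρ0 : 0 < ρ := hr.trans hρ
  have hsq : Real.sqrt (1 + gradSq n f x) = ρ / s := by rw [h1g, Real.sqrt_sq (by positivity)]
  let B : Matrix (Fin n) (Fin n) ℝ := s⁻¹ • (1 + Matrix.vecMulVec (grad n f x) (grad n f x))
  have hBA : (B - hess n f x).PosSemidef := by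
    refine .of_dotProduct_mulVec_nonneg ?_ fun v => ?_
    · ext i j
      simp [B, Matrix.one_apply, eq_comm, mul_comm, Matrix.vecMulVec_apply,
        (hess_isSymm hf x).apply i j]
    · have h := hsnd (WithLp.toLp 2 v)
      have hin : inner ℝ x (WithLp.toLp 2 v) = s * (grad n f x ⬝ᵥ v) := by
        simp only [PiLp.inner_apply, dotProduct, Finset.mul_sum, hgrad]
        refine Finset.sum_congr rfl fun i _ => ?_
        simp
        field_simp
      rw [Matrix.sub_mulVec, dotProduct_sub, star_trivial, dotProduct_hess_mulVec hf, sub_nonneg]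
      refine h.trans (le_of_eq ?_)
      rw [hin, EuclideanSpace.real_norm_sq_eq]
      simp only [B, Matrix.smul_mulVec, Matrix.add_mulVec, Matrix.one_mulVec,
        Matrix.vecMulVec_mulVec, dotProduct_smul, dotProduct_add, smul_eq_mul, op_smul_eq_smul]
      rw [dotProduct_comm v (grad n f x)]
      have : v ⬝ᵥ v = ∑ i, v i ^ 2 := by simp [dotProduct, sq]
      rw [this]
      field_simp
  have htr := (posSemidef_inverseMetric (f := f) x).trace_mul_nonneg hBA
  have hPB : ((1 : Matrix (Fin n) (Fin n) ℝ) -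
      Matrix.of fun i j => grad n f x i * grad n f x j / (1 + gradSq n f x)) * B = s⁻¹ • 1 := by
    have hof : (Matrix.of fun i j => grad n f x i * grad n f x j / (1 + gradSq n f x)) =
        (1 + gradSq n f x)⁻¹ • Matrix.vecMulVec (grad n f x) (grad n f x) := by
      ext i j
      simp [Matrix.vecMulVec_apply]
      ring
    have hvv : Matrix.vecMulVec (grad n f x) (grad n f x) *
        Matrix.vecMulVec (grad n f x) (grad n f x) =
        gradSq n f x • Matrix.vecMulVec (grad n f x) (grad n f x) := by
      rw [Matrix.vecMulVec_mul_vecMulVec]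
      ext i j
      simp [gradSq, dotProduct, Matrix.vecMulVec_apply, sq]
      ring
    have hg : 1 + gradSq n f x ≠ 0 := by linarith [gradSq_nonneg (f := f) x]
    rw [hof, Matrix.mul_smul]
    congr 1
    rw [sub_mul, mul_add, mul_add, Matrix.smul_mul, Matrix.smul_mul, hvv]
    ext i j
    simp
    field_simp
    ring
  rw [Matrix.mul_sub, Matrix.trace_sub, hPB, Matrix.trace_smul, Matrix.trace_one,
    Fintype.card_fin, smul_eq_mul, sub_nonneg] at htr
  rw [shapeOp, Matrix.trace_smul, smul_eq_mul, hsq]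
  calc _ ≤ (ρ / s)⁻¹ * (s⁻¹ * n) := by gcongr
    _ = n / ρ := by field_simp
    _ < n / r := by gcongr

theorem exists_scalarCurv_lt {n : ℕ} (hn : 2 ≤ n) {r : ℝ} (hr : 0 < r)
    {f : EuclideanSpace ℝ (Fin n) → ℝ} (hf : ContDiff ℝ 2 f) :
    ∃ x ∈ closedBall (0 : EuclideanSpace ℝ (Fin n)) r, scalarCurv n f x < 1 / r ^ 2 := by
  by_contra! hR
  have hn0 : (0 : ℝ) < n := by exact_mod_cast (by omega : 0 < n)
  have hT (x) (hx : x ∈ closedBall (0 : EuclideanSpace ℝ (Fin n)) r) :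
      n / r ≤ |(shapeOp n f x).trace| := by
    have h := (hR x hx).trans (scalarCurv_le hn hf x)
    rw [← one_div_pow, sq_le_sq, abs_of_pos (by positivity), abs_div, abs_of_pos hn0,
      le_div_iff₀ hn0] at h
    exact (le_of_eq (by ring)).trans h
  obtain ⟨x, hx, hxT⟩ := exists_trace_shapeOp_lt (by omega) hr hf
  obtain ⟨y, hy, hyT⟩ := exists_trace_shapeOp_lt (by omega) hr hf.neg
  change (shapeOp n (-f) y).trace < _ at hyT
  rw [shapeOp_neg, Matrix.trace_neg] at hyT
  have hnr : 0 < n / r := by positivity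
  have hx0 : (shapeOp n f x).trace ≤ 0 := by
    by_contra! h0
    linarith [hT x hx, abs_of_pos h0]
  have hy0 : 0 ≤ (shapeOp n f y).trace := by
    by_contra! h0
    linarith [hT y hy, abs_of_neg h0]
  obtain ⟨z, hz, hz0⟩ := (convex_closedBall (0 : EuclideanSpace ℝ (Fin n)) r).isPreconnected
    |>.intermediate_value hx hy (continuous_shapeOp hf).matrix_trace.continuousOn ⟨hx0, hy0⟩
  have := hT z hz
  simp only at hz0
  rw [hz0, abs_zero] at this
  linarith

/-- **Theorem 2, second part.** For a graph over the closed ball of radius `r` in `ℝⁿ`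
that has a point where the second fundamental form is semi-definite (equivalently,
the Hessian of `f` is positive or negative semidefinite there), `inf |R| < 1/r²`. -/
theorem inf_scalarCurv_lt_of_semidefinite_point
    (n : ℕ) (hn : 2 ≤ n) (r : ℝ) (hr : 0 < r)
    (f : EuclideanSpace ℝ (Fin n) → ℝ) (hf : ContDiff ℝ 2 f)
    (q : EuclideanSpace ℝ (Fin n)) (hq : q ∈ closedBall (0 : EuclideanSpace ℝ (Fin n)) r)
    (hsemi : (hess n f q).PosSemidef ∨ (-(hess n f q)).PosSemidef) :
    sInf ((fun x => |scalarCurv n f x|) '' closedBall (0 : EuclideanSpace ℝ (Fin n)) r)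
      < 1 / r ^ 2 := by
  by_contra! hinf
  have hR (x) (hx : x ∈ closedBall (0 : EuclideanSpace ℝ (Fin n)) r) :
      1 / r ^ 2 ≤ |scalarCurv n f x| :=
    hinf.trans (csInf_le ⟨0, by rintro _ ⟨y, -, rfl⟩; exact abs_nonneg _⟩ ⟨x, hx, rfl⟩)
  have hr2 : 0 < 1 / r ^ 2 := by positivity
  have hq0 : 0 ≤ scalarCurv n f q := by
    rcases hsemi with h | h
    · exact scalarCurv_nonneg hn h
    · rw [← hess_neg] at h
      exact scalarCurv_neg (f := f) q ▸ scalarCurv_nonneg hn h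
  obtain ⟨x, hx, hxR⟩ := exists_scalarCurv_lt hn hr hf
  have hx0 : scalarCurv n f x ≤ 0 := by
    by_contra! h0
    linarith [hR x hx, abs_of_pos h0]
  obtain ⟨z, hz, hz0⟩ := (convex_closedBall (0 : EuclideanSpace ℝ (Fin n)) r).isPreconnected
    |>.intermediate_value hx hq (continuous_scalarCurv hf).continuousOn ⟨hx0, hq0⟩
  have := hR z hz
  simp only at hz0
  rw [hz0, abs_zero] at this
  linarith
end
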